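/- Let d and d' be distinct integers with d, d' ≥ 3, and let T be a d-regular tree. Let G be a Hausdorff topological group with a faithful, vertex-transitive action on T by graph automorphisms such that: (a) every graph automorphism of T is induced by an element of G; (b) the stabilizer in G of each vertex of T is a compact open subgroup of G; and (c) the pointwise stabilizers in G of finite sets of vertices of T form a neighbourhood basis of the identity of G. Then there is no vertex-transitive action of G on a d'-regular tree T' by graph automorphisms with compact open vertex stabilizers; that is, the d'-regular tree is not a Cayley–Abels graph for Aut(T_d). -/

import Mathlib

universe u

namespace TreeCA

theorem adj_dist {V : Type*} {T : SimpleGraph V} (hT : T.IsTree) (x : V) {a b : V}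
    (h : T.Adj a b) : T.dist x a = T.dist x b + 1 ∨ T.dist x b = T.dist x a + 1 := by
  have := hT.dist_eq_dist_add_one_of_adj x h
  tauto

theorem closer_unique {V : Type*} {T : SimpleGraph V} (hT : T.IsTree) {x u a b : V}
    (ha : T.Adj u a) (hb : T.Adj u b) (hda : T.dist x u = T.dist x a + 1)
    (hdb : T.dist x u = T.dist x b + 1) : a = b := by
  obtain ⟨p, hp⟩ := hT.1.exists_walk_length_eq_dist x a
  obtain ⟨q, hq⟩ := hT.1.exists_walk_length_eq_dist x b
  have hp' : (p.concat ha.symm).IsPath := by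
    apply SimpleGraph.Walk.isPath_of_length_eq_dist
    simp [hp, hda]
  have hq' : (q.concat hb.symm).IsPath := by
    apply SimpleGraph.Walk.isPath_of_length_eq_dist
    simp [hq, hdb]
  have h := (hT.2.subsingleton_path x u).elim ⟨_, hp'⟩ ⟨_, hq'⟩
  have h2 : p.concat ha.symm = q.concat hb.symm := congrArg Subtype.val h
  have h3 := congrArg SimpleGraph.Walk.penultimate h2
  simpa using h3

theorem exists_closer {V : Type*} {T : SimpleGraph V} (hT : T.IsTree) {x u : V} {n : ℕ}
    (h : T.dist x u = n + 1) : ∃ a, T.Adj u a ∧ T.dist x a = n := by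
  obtain ⟨p, hp⟩ := hT.1.exists_walk_length_eq_dist u x
  rw [SimpleGraph.dist_comm, h] at hp
  cases p with
  | nil => simp at hp
  | @cons _ a _ hadj q =>
    refine ⟨a, hadj, ?_⟩
    have h1 := SimpleGraph.dist_le q
    rw [SimpleGraph.dist_comm] at h1
    simp at hp
    rcases adj_dist hT x hadj with h2 | h2 <;> omega

theorem tri {V : Type*} {T : SimpleGraph V} (hT : T.IsTree) (a b c : V) :
    T.dist a c ≤ T.dist a b + T.dist b c := hT.1.dist_triangle

theorem adj_one {V : Type*} {T : SimpleGraph V} {a b : V} :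
    T.dist a b = 1 ↔ T.Adj a b := SimpleGraph.dist_eq_one_iff_adj

theorem dist_zero {V : Type*} {T : SimpleGraph V} (hT : T.IsTree) {a b : V} :
    T.dist a b = 0 ↔ a = b := hT.1.dist_eq_zero_iff

theorem no_triangle {V : Type*} {T : SimpleGraph V} (hT : T.IsTree) {a b c : V}
    (h1 : T.Adj a b) (h2 : T.Adj b c) (h3 : T.Adj a c) : False := by
  have e1 := adj_one.2 h1
  have e3 := adj_one.2 h3
  rcases adj_dist hT a h2 with h | h <;> omega

theorem no_square {V : Type*} {T : SimpleGraph V} (hT : T.IsTree) {a b c e : V}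
    (h1 : T.Adj a b) (h2 : T.Adj b c) (h3 : T.Adj c e) (h4 : T.Adj e a) (hac : a ≠ c)
    (hbe : b ≠ e) : False := by
  have e1 := adj_one.2 h1
  have e4 := adj_one.2 h4.symm
  have e0 : T.dist a c ≠ 0 := fun h => hac ((dist_zero hT).1 h)
  have e2 : T.dist a c = 2 := by
    rcases adj_dist hT a h2 with h | h <;> omega
  exact hbe (closer_unique hT (x := a) h2.symm h3 (by omega) (by omega))

/-- Branch lemma: the edge `w - x` separates `o` from `y`. -/
theorem branch {V : Type*} {T : SimpleGraph V} (hT : T.IsTree) {o w x : V}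
    (hwx : T.Adj w x) (ho : T.dist o x = T.dist o w + 1) (n : ℕ) :
    ∀ y, T.dist x y = n → T.dist w y = n + 1 → T.dist o y = T.dist o w + T.dist w y := by
  induction n with
  | zero =>
    intro y h1 h2
    have := (dist_zero hT).1 h1
    subst this
    omega
  | succ n ih =>
    intro y h1 h2
    obtain ⟨y1, hy1, hd1⟩ := exists_closer hT h1
    have a1 := adj_one.2 hy1.symm
    have a2 := tri hT w y1 y
    have a3 := tri hT w x y1
    have a4 := adj_one.2 hwx
    have hd2 : T.dist w y1 = n + 1 := by omega
    have hi := ih y1 hd1 hd2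
    obtain ⟨y2, hy2, hd3⟩ := exists_closer hT hd2
    rcases adj_dist hT o hy1 with h | h
    · omega
    · exfalso
      have b1 := tri hT o w y2
      have hy2' : T.dist o y1 = T.dist o y2 + 1 := by
        rcases adj_dist hT o hy2 with h | h <;> omega
      have := closer_unique hT (x := o) hy1.symm hy2 h hy2'
      subst this
      omega

theorem nbr_finite {V : Type*} {T : SimpleGraph V} {d : ℕ} (hd : 3 ≤ d)
    (hreg : ∀ v : V, (T.neighborSet v).ncard = d) (v : V) : (T.neighborSet v).Finite :=
  Set.finite_of_ncard_pos (by rw [hreg]; omega)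

/-- A third neighbour. -/
theorem third_nbr {V : Type*} {T : SimpleGraph V} {d : ℕ} (hd : 3 ≤ d)
    (hreg : ∀ v : V, (T.neighborSet v).ncard = d) (v a b : V) :
    ∃ c, T.Adj v c ∧ c ≠ a ∧ c ≠ b := by
  have h : ({a, b} : Set V).ncard < (T.neighborSet v).ncard := by
    have := Set.ncard_insert_le a {b}
    rw [Set.ncard_singleton] at this
    rw [hreg]; omega
  obtain ⟨c, hc, hc'⟩ := Set.exists_mem_notMem_of_ncard_lt_ncard h
  simp at hc'
  exact ⟨c, hc, hc'.1, hc'.2⟩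

/-- Parent-preserving bijections of neighbourhoods. -/
theorem exists_bij {V : Type*} {T : SimpleGraph V} {d : ℕ} (hd : 3 ≤ d)
    (hreg : ∀ v : V, (T.neighborSet v).ncard = d) (p p' s s' : V) (hs : T.Adj p s)
    (hs' : T.Adj p' s') : ∃ f : V → V, Set.BijOn f (T.neighborSet p) (T.neighborSet p') ∧
      f s = s' := by
  classical
  have : Nonempty V := ⟨p⟩
  have hf := nbr_finite hd hreg p
  have hf' := nbr_finite hd hreg p'
  obtain ⟨f, hfb⟩ := hf.exists_bijOn_of_encard_eq (t := T.neighborSet p') (by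
    rw [← hf.cast_ncard_eq, ← hf'.cast_ncard_eq, hreg, hreg])
  refine ⟨Equiv.swap (f s) s' ∘ f, ?_, by simp⟩
  refine Set.BijOn.comp (t := T.neighborSet p') ?_ hfb
  refine ⟨?_, (Equiv.injective _).injOn, ?_⟩
  · intro z hz
    by_cases h1 : z = f s
    · subst h1; simpa using hs'
    · by_cases h2 : z = s'
      · subst h2; simpa using hfb.mapsTo hs
      · rwa [Equiv.swap_apply_of_ne_of_ne h1 h2]
  · intro z hz
    refine ⟨Equiv.swap (f s) s' z, ?_, by simp⟩
    by_cases h1 : z = f s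
    · subst h1; simpa using hs'
    · by_cases h2 : z = s'
      · subst h2; simpa using hfb.mapsTo hs
      · rwa [Equiv.swap_apply_of_ne_of_ne h1 h2]

/-- Auxiliary recursion for building a rooted automorphism level by level. -/
def extAux {V : Type*} (u : V) (par : V → V) (β : V → V → V → V) : ℕ → V → V
  | 0, _ => u
  | n + 1, w => β (par w) (extAux u par β n (par w)) w

theorem extend {V : Type*} {T : SimpleGraph V} (hT : T.IsTree) (u : V) (par : V → V)
    (hpar : ∀ w, w ≠ u → T.Adj w (par w) ∧ T.dist u w = T.dist u (par w) + 1)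
    (β : V → V → V → V)
    (hβ : ∀ p p', T.dist u p = T.dist u p' →
      Set.BijOn (β p p') (T.neighborSet p) (T.neighborSet p'))
    (hβp : ∀ p p', T.dist u p = T.dist u p' → p ≠ u → β p p' (par p) = par p') :
    ∃ φ : T ≃g T, φ u = u ∧ ∀ w, w ≠ u → φ w = β (par w) (φ (par w)) w := by
  obtain ⟨f, hfu, hf⟩ : ∃ f : V → V, f u = u ∧ ∀ w, w ≠ u → f w = β (par w) (f (par w)) w := by
    refine ⟨fun w => extAux u par β (T.dist u w) w, by simp [extAux], ?_⟩
    intro w hw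
    simp only []
    rw [(hpar w hw).2]
    rfl
  have ne_of_pos : ∀ w, T.dist u w ≠ 0 → w ≠ u := by
    rintro w hw rfl; simp at hw
  have pos_of_ne : ∀ w, w ≠ u → T.dist u w ≠ 0 := fun w hw h => hw ((dist_zero hT).1 h).symm
  -- a child is a neighbour different from the parent
  have child : ∀ p w, T.Adj p w → (p ≠ u → w ≠ par p) →
      T.dist u w = T.dist u p + 1 ∧ par w = p := by
    intro p w hpw hne
    have h1 : T.dist u w = T.dist u p + 1 := by
      rcases adj_dist hT u hpw with h | h
      · exfalso
        have hpu : p ≠ u := ne_of_pos _ (by omega)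
        exact hne hpu (closer_unique hT hpw (hpar p hpu).1 h (hpar p hpu).2)
      · exact h
    have hwu : w ≠ u := ne_of_pos _ (by omega)
    exact ⟨h1, closer_unique hT (hpar w hwu).1 hpw.symm (hpar w hwu).2 h1⟩
  have childpar : ∀ w, w ≠ u → par w ≠ u → w ≠ par (par w) := by
    intro w hw hp h
    have h1 := (hpar w hw).2
    have h2 := (hpar _ hp).2
    rw [← h] at h2
    omega
  have key : ∀ n w, T.dist u w = n → T.dist u (f w) = n ∧
      (w ≠ u → par (f w) = f (par w)) := by
    intro n
    induction n with
    | zero =>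
      intro w hw
      have := (dist_zero hT).1 hw
      subst this
      simp [hfu]
    | succ n ih =>
      intro w hw
      have hwu : w ≠ u := ne_of_pos _ (by omega)
      obtain ⟨hadj, hd⟩ := hpar w hwu
      have hdn : T.dist u (par w) = n := by omega
      obtain ⟨i1, i2⟩ := ih _ hdn
      have hbij := hβ (par w) (f (par w)) (by omega)
      have h1 : T.Adj (f (par w)) (f w) := by
        rw [hf w hwu]
        exact hbij.mapsTo hadj.symm
      have h2 := child _ _ h1 (by
        intro hne heq
        have hpu : par w ≠ u := by
          intro h; rw [h, hfu] at hne; exact hne rfl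
        rw [← hβp (par w) (f (par w)) (by omega) hpu, hf w hwu] at heq
        exact childpar w hwu hpu (hbij.injOn hadj.symm (hpar _ hpu).1 heq))
      exact ⟨by omega, fun _ => h2.2⟩
  have hdist : ∀ w, T.dist u (f w) = T.dist u w := fun w => (key _ w rfl).1
  have hparf : ∀ w, w ≠ u → par (f w) = f (par w) := fun w => (key _ w rfl).2
  have hfne : ∀ w, w ≠ u → f w ≠ u := fun w hw => ne_of_pos _ (by
    rw [hdist]; exact pos_of_ne w hw)
  have inj : ∀ n w w', T.dist u w = n → f w = f w' → w = w' := by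
    intro n
    induction n with
    | zero =>
      intro w w' hw h
      have h2 := hdist w'
      rw [← h, hdist, hw] at h2
      rw [← (dist_zero hT).1 hw, ← (dist_zero hT).1 h2.symm]
    | succ n ih =>
      intro w w' hw h
      have h2 := hdist w'
      rw [← h, hdist, hw] at h2
      have hwu : w ≠ u := ne_of_pos _ (by omega)
      have hwu' : w' ≠ u := ne_of_pos _ (by omega)
      have hp : par w = par w' := by
        apply ih _ _ (by have := (hpar w hwu).2; omega)
        rw [← hparf w hwu, ← hparf w' hwu', h]
      rw [hf w hwu, hf w' hwu', ← hp] at h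
      refine (hβ (par w) (f (par w)) (hdist _).symm).injOn (hpar w hwu).1.symm ?_ h
      have := (hpar w' hwu').1.symm
      rwa [← hp] at this
  have hinj : Function.Injective f := fun w w' h => inj _ w w' rfl h
  have surj : ∀ n y, T.dist u y = n → ∃ w, f w = y := by
    intro n
    induction n with
    | zero =>
      intro y hy
      exact ⟨u, by rw [hfu, (dist_zero hT).1 hy]⟩
    | succ n ih =>
      intro y hy
      have hyu : y ≠ u := ne_of_pos _ (by omega)
      obtain ⟨hadj, hd⟩ := hpar y hyu
      obtain ⟨p, hp⟩ := ih (par y) (by omega)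
      have hbij := hβ p (f p) (hdist _).symm
      obtain ⟨w, hw, hwy⟩ := hbij.surjOn (show y ∈ T.neighborSet (f p) by
        rw [hp]; exact hadj.symm)
      have hc := child p w hw (by
        intro hpu heq
        rw [heq, hβp p (f p) (hdist _).symm hpu, hp] at hwy
        refine childpar y hyu ?_ hwy.symm
        rw [← hp]
        exact hfne p hpu)
      refine ⟨w, ?_⟩
      rw [hf w (ne_of_pos _ (by omega)), hc.2, hwy]
  have hadjpar : ∀ a b, T.Adj a b → (a ≠ u ∧ par a = b) ∨ (b ≠ u ∧ par b = a) := by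
    intro a b hab
    rcases adj_dist hT u hab with h | h
    · left
      have hau : a ≠ u := ne_of_pos _ (by omega)
      exact ⟨hau, closer_unique hT (hpar a hau).1 hab (hpar a hau).2 h⟩
    · right
      have hau : b ≠ u := ne_of_pos _ (by omega)
      exact ⟨hau, closer_unique hT (hpar b hau).1 hab.symm (hpar b hau).2 h⟩
  have hne_of : ∀ w, f w ≠ u → w ≠ u := by
    rintro w hw rfl; exact hw hfu
  have hsurj : Function.Surjective f := fun y => surj _ y rfl
  refine ⟨⟨Equiv.ofBijective f ⟨hinj, hsurj⟩, ?_⟩, hfu, hf⟩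
  intro a b
  change T.Adj (f a) (f b) ↔ T.Adj a b
  constructor
  · intro h
    rcases hadjpar _ _ h with ⟨h1, h2⟩ | ⟨h1, h2⟩
    · rw [hparf a (hne_of _ h1)] at h2
      rw [← hinj h2]
      exact (hpar a (hne_of _ h1)).1
    · rw [hparf b (hne_of _ h1)] at h2
      rw [← hinj h2]
      exact (hpar b (hne_of _ h1)).1.symm
  · intro h
    rcases hadjpar _ _ h with ⟨h1, h2⟩ | ⟨h1, h2⟩
    · rw [← h2, ← hparf a h1]
      exact (hpar _ (hfne a h1)).1
    · rw [← h2, ← hparf b h1]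
      exact (hpar _ (hfne b h1)).1.symm

/-- Automorphism swapping two branches at `u`. -/
theorem exists_swap {V : Type*} {T : SimpleGraph V} (hT : T.IsTree) {d : ℕ} (hd : 3 ≤ d)
    (hreg : ∀ v : V, (T.neighborSet v).ncard = d) {u a b : V} (ha : T.Adj u a)
    (hb : T.Adj u b) : ∃ φ : T ≃g T, φ u = u ∧ φ a = b ∧
      ∀ w, T.dist a w = T.dist u w + 1 → T.dist b w = T.dist u w + 1 → φ w = w := by
  classical
  have hparE : ∀ w, ∃ q, w ≠ u → T.Adj w q ∧ T.dist u w = T.dist u q + 1 := by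
    intro w
    by_cases hw : w = u
    · exact ⟨w, fun h => absurd hw h⟩
    · have : T.dist u w ≠ 0 := fun h => hw ((dist_zero hT).1 h).symm
      obtain ⟨n, hn⟩ := Nat.exists_eq_succ_of_ne_zero this
      obtain ⟨q, hq, hq'⟩ := exists_closer hT hn
      exact ⟨q, fun _ => ⟨hq, by omega⟩⟩
  choose par hpar using hparE
  have hβE : ∀ p p', ∃ f : V → V, (p = u → p' = u → f = Equiv.swap a b) ∧
      (p ≠ u → p' = p → f = id) ∧
      (T.dist u p = T.dist u p' → Set.BijOn f (T.neighborSet p) (T.neighborSet p') ∧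
      (p ≠ u → f (par p) = par p')) := by
    intro p p'
    by_cases hp : p = u
    · by_cases hp' : p' = u
      · subst hp
        subst hp'
        refine ⟨Equiv.swap a b, by simp, by simp, fun _ => ⟨?_, by simp⟩⟩
        have hm : ∀ z, T.Adj p' z → T.Adj p' (Equiv.swap a b z) := by
          intro z hz
          by_cases h1 : z = a
          · subst h1; simpa using hb
          · by_cases h2 : z = b
            · subst h2; simpa using ha
            · rwa [Equiv.swap_apply_of_ne_of_ne h1 h2]
        refine ⟨fun z hz => hm z hz, (Equiv.injective _).injOn, fun z hz => ⟨_, hm z hz, by simp⟩⟩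
      · refine ⟨id, fun _ h => absurd h hp', fun _ _ => rfl, fun h => ?_⟩
        rw [hp, SimpleGraph.dist_self] at h
        exact absurd ((dist_zero hT).1 h.symm).symm hp'
    · by_cases hpp : p' = p
      · subst hpp
        exact ⟨id, fun h => absurd h hp, fun _ _ => rfl, fun _ => ⟨Set.bijOn_id _, fun _ => rfl⟩⟩
      · by_cases hp' : p' = u
        · refine ⟨id, fun h => absurd h hp, fun _ _ => rfl, fun h => ?_⟩
          rw [hp', SimpleGraph.dist_self] at h
          exact absurd ((dist_zero hT).1 h).symm hp
        · obtain ⟨f, h1, h2⟩ := exists_bij hd hreg p p' (par p) (par p') (hpar p hp).1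
            (hpar p' hp').1
          exact ⟨f, fun h => absurd h hp, fun _ h => absurd h hpp, fun _ => ⟨h1, fun _ => h2⟩⟩
  choose β hβ using hβE
  obtain ⟨φ, hφu, hφ⟩ := extend hT u par hpar β (fun p p' h => ((hβ p p').2.2 h).1)
    (fun p p' h hp => ((hβ p p').2.2 h).2 hp)
  have hpar1 : ∀ w, T.Adj u w → par w = u := by
    intro w hw
    have hwu : w ≠ u := hw.ne'
    have := (hpar w hwu).2
    rw [adj_one.2 hw] at this
    exact ((dist_zero hT).1 (by omega)).symm
  have hφ1 : ∀ w, T.Adj u w → φ w = Equiv.swap a b w := by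
    intro w hw
    rw [hφ w hw.ne', hpar1 w hw, hφu, (hβ u u).1 rfl rfl]
  refine ⟨φ, hφu, by rw [hφ1 a ha]; simp, ?_⟩
  have main : ∀ n w, T.dist u w = n → T.dist a w = T.dist u w + 1 →
      T.dist b w = T.dist u w + 1 → φ w = w := by
    intro n
    induction n with
    | zero =>
      intro w hw _ _
      rw [← (dist_zero hT).1 hw, hφu]
    | succ n ih =>
      intro w hw h1 h2
      have hwu : w ≠ u := by rintro rfl; simp at hw
      obtain ⟨hadj, hdp⟩ := hpar w hwu
      by_cases hpu : par w = u
      · rw [hpu] at hadj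
        rw [hφ1 w hadj.symm]
        apply Equiv.swap_apply_of_ne_of_ne
        · rintro rfl; simp at h1
        · rintro rfl; simp at h2
      · have ew : T.dist (par w) w = 1 := adj_one.2 hadj.symm
        have e1 := tri hT a (par w) w
        have e2 := tri hT b (par w) w
        have e3 := tri hT a u (par w)
        have e4 := tri hT b u (par w)
        have e5 := adj_one.2 ha.symm
        have e6 := adj_one.2 hb.symm
        have := ih (par w) (by omega) (by omega) (by omega)
        rw [hφ w hwu, this, (hβ _ _).2.1 hpu rfl]
        rfl
  exact fun w => main _ w rfl

theorem iso_dist {V : Type*} {T : SimpleGraph V} (hT : T.IsTree) (φ : T ≃g T) (a b : V) :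
    T.dist (φ a) (φ b) = T.dist a b := by
  have : ∀ (ψ : T ≃g T) (a b : V), T.dist (ψ a) (ψ b) ≤ T.dist a b := by
    intro ψ a b
    obtain ⟨p, hp⟩ := hT.1.exists_walk_length_eq_dist a b
    rw [← hp]
    have := SimpleGraph.dist_le (p.map ψ.toHom)
    simpa using this
  apply le_antisymm (this φ a b)
  simpa using this φ.symm (φ a) (φ b)

theorem sphere_aux {V : Type*} {T : SimpleGraph V} (hT : T.IsTree) {d : ℕ} (hd : 3 ≤ d)
    (hreg : ∀ v : V, (T.neighborSet v).ncard = d) {v z : V} (hz : T.Adj v z) (k : ℕ) :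
    ∀ x y, T.dist v x = k → T.dist v y = k → T.dist z x = k + 1 → T.dist z y = k + 1 →
    ∃ φ : T ≃g T, φ v = v ∧ φ x = y ∧ ∀ w, T.dist v w = T.dist z w + 1 → φ w = w := by
  induction k with
  | zero =>
    intro x y hx hy _ _
    refine ⟨SimpleGraph.Iso.refl, rfl, ?_, fun _ _ => rfl⟩
    rw [← (dist_zero hT).1 hx, ← (dist_zero hT).1 hy]
    rfl
  | succ k ih =>
    intro x y hx hy hzx hzy
    obtain ⟨x0, hx0, hdx⟩ := exists_closer hT hx
    obtain ⟨y0, hy0, hdy⟩ := exists_closer hT hy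
    have ez := adj_one.2 hz.symm
    have ex := adj_one.2 hx0.symm
    have ey := adj_one.2 hy0.symm
    have t1 := tri hT z v x0
    have t2 := tri hT z v y0
    have t3 := tri hT z x0 x
    have t4 := tri hT z y0 y
    obtain ⟨φ, h1, h2, h3⟩ := ih x0 y0 hdx hdy (by omega) (by omega)
    have hzf : φ z = z := h3 z (by simp [adj_one.2 hz])
    have hadj : T.Adj y0 (φ x) := by
      rw [← h2]; exact φ.map_rel_iff.2 hx0.symm
    have hv : T.dist v (φ x) = k + 1 := by
      have := iso_dist hT φ v x
      rw [h1] at this; omega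
    have hzv : T.dist z (φ x) = k + 1 + 1 := by
      have := iso_dist hT φ z x
      rw [hzf] at this; omega
    obtain ⟨ψ, g1, g2, g3⟩ := exists_swap hT hd hreg hadj hy0.symm
    refine ⟨φ.trans ψ, ?_, ?_, ?_⟩
    · change ψ (φ v) = v
      rw [h1]
      apply g3
      · rw [SimpleGraph.dist_comm, hv, SimpleGraph.dist_comm, hdy]
      · rw [SimpleGraph.dist_comm, hy, SimpleGraph.dist_comm, hdy]
    · change ψ (φ x) = y
      exact g2
    · intro w hw
      change ψ (φ w) = w
      rw [h3 w hw]
      have hw' : T.dist w v = T.dist w z + 1 := by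
        rw [SimpleGraph.dist_comm, hw, SimpleGraph.dist_comm]
      have b1 := branch hT hz.symm hw' _ (φ x) rfl (by omega)
      have b2 := branch hT hz.symm hw' _ y rfl (by omega)
      have b3 := branch hT hz.symm hw' _ y0 rfl (by omega)
      have c1 : T.dist (φ x) w = T.dist w (φ x) := SimpleGraph.dist_comm
      have c2 : T.dist y w = T.dist w y := SimpleGraph.dist_comm
      have c3 : T.dist y0 w = T.dist w y0 := SimpleGraph.dist_comm
      have hz0 : T.dist z y0 = k + 1 := by clear b1 b2 b3 c1 c2 c3; omega
      exact g3 w (by rw [c1, b1, c3, b3, hzv, hz0]; rfl) (by rw [c2, b2, c3, b3, hzy, hz0]; rfl)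

theorem sphere {V : Type*} {T : SimpleGraph V} (hT : T.IsTree) {d : ℕ} (hd : 3 ≤ d)
    (hreg : ∀ v : V, (T.neighborSet v).ncard = d) {v x y : V} {k : ℕ}
    (hx : T.dist v x = k + 1) (hy : T.dist v y = k + 1) :
    ∃ (z : V) (φ : T ≃g T), T.dist v z = k + 1 ∧ z ≠ x ∧ z ≠ y ∧ φ v = v ∧ φ x = y ∧
      φ z = z := by
  have c : ∀ a b, T.dist a b = T.dist b a := fun a b => SimpleGraph.dist_comm
  obtain ⟨x1, hx1, dx1⟩ := exists_closer hT ((c x v).trans hx)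
  obtain ⟨y1, hy1, dy1⟩ := exists_closer hT ((c y v).trans hy)
  obtain ⟨z1, hz1, hzx, hzy⟩ := third_nbr hd hreg v x1 y1
  have hzx' : T.dist z1 x = k + 1 + 1 := by
    rw [c]
    rcases adj_dist hT x hz1 with h | h
    · exact absurd (closer_unique hT hz1 hx1 h (by rw [c, hx, dx1])) hzx
    · rw [h, c, hx]
  have hzy' : T.dist z1 y = k + 1 + 1 := by
    rw [c]
    rcases adj_dist hT y hz1 with h | h
    · exact absurd (closer_unique hT hz1 hy1 h (by rw [c, hy, dy1])) hzy
    · rw [h, c, hy]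
  obtain ⟨φ, h1, h2, h3⟩ := sphere_aux hT hd hreg hz1 _ x y hx hy hzx' hzy'
  obtain ⟨ψ, g1, g2, -⟩ := exists_swap hT hd hreg hx1 hz1
  have e1 := iso_dist hT ψ v x
  have e2 := iso_dist hT ψ x1 x
  rw [g1] at e1
  rw [g2, c x1 x, dx1] at e2
  refine ⟨ψ x, φ, by omega, ?_, ?_, h1, h2, h3 _ (by omega)⟩
  · intro h; rw [h] at e2; omega
  · intro h; rw [h] at e2; omega

theorem act_iso {V G : Type*} [Group G] {T : SimpleGraph V} (ρ : G →* Equiv.Perm V)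
    (hpres : ∀ (g : G) (u v : V), T.Adj u v → T.Adj (ρ g u) (ρ g v)) (g : G) :
    ∃ φ : T ≃g T, ∀ v, φ v = ρ g v := by
  refine ⟨⟨ρ g, ?_⟩, fun _ => rfl⟩
  intro a b
  refine ⟨fun h => ?_, hpres g a b⟩
  have := hpres g⁻¹ _ _ h
  simpa using this

theorem act_dist {V G : Type*} [Group G] {T : SimpleGraph V} (hT : T.IsTree)
    (ρ : G →* Equiv.Perm V)
    (hpres : ∀ (g : G) (u v : V), T.Adj u v → T.Adj (ρ g u) (ρ g v)) (g : G) (a b : V) :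
    T.dist (ρ g a) (ρ g b) = T.dist a b := by
  obtain ⟨φ, hφ⟩ := act_iso ρ hpres g
  rw [← hφ, ← hφ]
  exact iso_dist hT φ a b

theorem fixed_pair {V G : Type*} [Group G] {T : SimpleGraph V} (hT : T.IsTree)
    (ρ : G →* Equiv.Perm V)
    (hpres : ∀ (g : G) (u v : V), T.Adj u v → T.Adj (ρ g u) (ρ g v)) (K : Subgroup G) (o : V)
    (hfin : ((fun g => ρ g o) '' (K : Set G)).Finite) :
    ∃ a b, (a = b ∨ T.Adj a b) ∧
      ∀ g ∈ K, (ρ g a = a ∧ ρ g b = b) ∨ (ρ g a = b ∧ ρ g b = a) := by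
  classical
  have hex : ∃ m, ∃ w, ∀ h ∈ K, T.dist w (ρ h o) ≤ m := by
    obtain ⟨m, hm⟩ := (hfin.image (T.dist o)).bddAbove
    exact ⟨m, o, fun h hh => hm ⟨_, ⟨h, hh, rfl⟩, rfl⟩⟩
  obtain ⟨a, ha⟩ := Nat.find_spec hex
  have hmin : ∀ m, m < Nat.find hex → ¬ _ := fun m hm => Nat.find_min hex hm
  generalize Nat.find hex = m at ha hmin
  have hC : ∀ w w', (∀ h ∈ K, T.dist w (ρ h o) ≤ m) → (∀ h ∈ K, T.dist w' (ρ h o) ≤ m) →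
      w ≠ w' → T.Adj w w' := by
    intro w w' hw hw' hne
    by_contra hadj
    have h0 : T.dist w w' ≠ 0 := fun h => hne ((dist_zero hT).1 h)
    have h1 : T.dist w w' ≠ 1 := fun h => hadj (adj_one.1 h)
    obtain ⟨n, hn⟩ : ∃ n, T.dist w' w = n + 1 + 1 :=
      ⟨T.dist w w' - 2, by rw [SimpleGraph.dist_comm]; omega⟩
    obtain ⟨x, hx, hdx⟩ := exists_closer hT hn
    have key : ∀ h ∈ K, T.dist x (ρ h o) + 1 ≤ m := by
      intro h hh
      have e1 := hw h hh
      have e2 := hw' h hh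
      rw [SimpleGraph.dist_comm] at e1 e2 ⊢
      rcases adj_dist hT (ρ h o) hx with h3 | h3
      · omega
      · have := branch hT hx h3 (n + 1) w' (by rw [SimpleGraph.dist_comm, hdx])
          (by rw [SimpleGraph.dist_comm, hn])
        rw [SimpleGraph.dist_comm (u := w), hn] at this
        omega
    have k1 := key 1 K.one_mem
    exact hmin (m - 1) (by omega) ⟨x, fun h hh => by have := key h hh; omega⟩
  have hinv : ∀ g ∈ K, ∀ w, (∀ h ∈ K, T.dist w (ρ h o) ≤ m) →
      (∀ h ∈ K, T.dist (ρ g w) (ρ h o) ≤ m) := by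
    intro g hg w hw h hh
    have h1 := hw (g⁻¹ * h) (K.mul_mem (K.inv_mem hg) hh)
    have h2 := act_dist hT ρ hpres g w (ρ (g⁻¹ * h) o)
    rw [← h2] at h1
    simpa using h1
  by_cases hb : ∃ b, (∀ h ∈ K, T.dist b (ρ h o) ≤ m) ∧ a ≠ b
  · obtain ⟨b, hb, hab⟩ := hb
    have adj := hC a b ha hb hab
    have hall : ∀ c, (∀ h ∈ K, T.dist c (ρ h o) ≤ m) → c = a ∨ c = b := by
      intro c hc
      by_contra hcon
      push Not at hcon
      exact no_triangle hT adj (hC b c hb hc hcon.2.symm) (hC a c ha hc hcon.1.symm)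
    refine ⟨a, b, Or.inr adj, fun g hg => ?_⟩
    have hinj := (ρ g).injective.ne hab
    rcases hall _ (hinv g hg a ha) with h1 | h1 <;> rcases hall _ (hinv g hg b hb) with h2 | h2
    · exact absurd (h1.trans h2.symm) hinj
    · exact Or.inl ⟨h1, h2⟩
    · exact Or.inr ⟨h1, h2⟩
    · exact absurd (h1.trans h2.symm) hinj
  · push Not at hb
    refine ⟨a, a, Or.inl rfl, fun g hg => ?_⟩
    have := hb _ (hinv g hg a ha)
    exact Or.inl ⟨this.symm, this.symm⟩

theorem orbit_finite {W G : Type*} [Group G] [TopologicalSpace G] [IsTopologicalGroup G]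
    (σ : G →* Equiv.Perm W) (w : W) (ho : IsOpen {g : G | σ g w = w}) (K : Set G)
    (hK : IsCompact K) : ((fun g => σ g w) '' K).Finite := by
  letI : TopologicalSpace W := ⊥
  haveI : DiscreteTopology W := ⟨rfl⟩
  have hc : Continuous (fun g => σ g w) := by
    rw [continuous_discrete_rng]
    intro w'
    rw [isOpen_iff_mem_nhds]
    intro g hg
    have h1 : IsOpen ((fun h => g⁻¹ * h) ⁻¹' {g : G | σ g w = w}) :=
      ho.preimage (continuous_const_mul g⁻¹)
    refine Filter.mem_of_superset (h1.mem_nhds (by simp)) ?_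
    intro h hh
    simp only [Set.mem_preimage, Set.mem_setOf_eq, map_mul, map_inv, Equiv.Perm.mul_apply,
      Equiv.Perm.inv_eq_iff_eq] at hh
    simp only [Set.mem_preimage, Set.mem_singleton_iff] at hg ⊢
    rw [hh, hg]
  exact (hK.image hc).finite_of_discrete

/-- The stabilizer as a subgroup. -/
def stab {W G : Type*} [Group G] (σ : G →* Equiv.Perm W) (w : W) : Subgroup G where
  carrier := {g | σ g w = w}
  one_mem' := by simp
  mul_mem' := by
    intro a b ha hb
    simp only [Set.mem_setOf_eq, map_mul, Equiv.Perm.mul_apply] at *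
    rw [hb, ha]
  inv_mem' := by
    intro a ha
    simp only [Set.mem_setOf_eq, map_inv, Equiv.Perm.inv_eq_iff_eq] at *
    exact ha.symm

/-- A relation on vertices containing all pairs at distance `k ≥ 2` has a short cycle. -/
theorem short_cycle {V W : Type*} {T : SimpleGraph V} {T' : SimpleGraph W} (hT : T.IsTree)
    (hT' : T'.IsTree) {d : ℕ} (hd : 3 ≤ d)
    (hreg : ∀ v : V, (T.neighborSet v).ncard = d) (f : V → W) (hf : Function.Injective f)
    (k : ℕ) (v x : V) (hvx : T.dist v x = k + 2)
    (hR : ∀ p q, T.dist p q = k + 2 → T'.Adj (f p) (f q)) : False := by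
  have c : ∀ a b, T.dist a b = T.dist b a := fun a b => SimpleGraph.dist_comm
  obtain ⟨p, hp, hdp⟩ := exists_closer hT ((c x v).trans hvx)
  cases k with
  | zero =>
    obtain ⟨z, hz, hzv, hzx⟩ := third_nbr hd hreg p v x
    have hpx : T.Adj p x := adj_one.1 (by rw [c, hdp])
    have h2 : ∀ s t, T.Adj p s → T.Adj p t → s ≠ t → T.dist s t = 2 := by
      intro s t hs ht hst
      have h0 : T.dist s t ≠ 0 := fun h => hst ((dist_zero hT).1 h)
      have h1 := adj_one.2 hs.symm
      rcases adj_dist hT s ht with h | h <;> omega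
    exact no_triangle hT' (hR v x hvx) (hR x z (h2 x z hpx hz hzx.symm))
      (hR v z (h2 v z hp.symm hz hzv.symm))
  | succ k =>
    have hpx : T.dist p x = k + 1 + 1 := by rw [c, hdp]
    obtain ⟨q, hq, hdq⟩ := exists_closer hT hpx
    obtain ⟨r, hr, hdr⟩ := exists_closer hT hdq
    -- a second neighbour of p at distance k + 3 from x
    obtain ⟨p2, hp2, hdp2⟩ := exists_closer hT hdp
    obtain ⟨v', hv', hv'v, hv'p⟩ := third_nbr hd hreg p v p2
    have hv'x : T.dist x v' = k + 3 := by
      rcases adj_dist hT x hv' with h | h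
      · exact absurd (closer_unique hT hv' hp2 h (by omega)) hv'p
      · omega
    obtain ⟨x', hx', hx'x, hx'r⟩ := third_nbr hd hreg q x r
    have hgen : ∀ s, T.Adj s p → T.dist s x = k + 3 → T.dist s x' = k + 3 := by
      intro s hs hsx
      have e1 := adj_one.2 hs
      have e2 := tri hT s p q
      have e3 := tri hT s q x
      have e4 := adj_one.2 hq.symm
      have e5 := tri hT s p r
      have e6 := tri hT s r q
      have e7 := adj_one.2 hr.symm
      rcases adj_dist hT s hx' with h | h
      · exact absurd (closer_unique hT hx' hr h (by omega)) hx'r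
      · omega
    have hv'x2 : T.dist v' x = k + 3 := by rw [c]; exact hv'x
    have a1 := hR v x hvx
    have a2 := hR v' x hv'x2
    have a3 := hR v x' (hgen v hp hvx)
    have a4 := hR v' x' (hgen v' hv'.symm hv'x2)
    exact no_square hT' a1 a2.symm a4 a3.symm (fun h => hv'v (hf h).symm)
      (fun h => hx'x (hf h).symm)

end TreeCA

open TreeCA

/-- Let `d ≠ d'` with `d, d' ≥ 3` and let `T` be a `d`-regular tree.  If `G` is a Hausdorff
topological group with a faithful vertex-transitive action on `T` by graph automorphisms
such that every automorphism of `T` is induced by an element of `G`, vertex stabilizers are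
compact open, and pointwise stabilizers of finite vertex sets form a neighbourhood basis of
the identity (so `G` is `Aut(T_d)` with the permutation topology), then there is no
vertex-transitive action of `G` on a `d'`-regular tree by graph automorphisms with compact
open vertex stabilizers; that is, the `d'`-regular tree is not a Cayley–Abels graph
for `Aut(T_d)`. -/
theorem no_other_regular_tree_CayleyAbels {V : Type*} (G : Type*) [Group G]
    [TopologicalSpace G] [IsTopologicalGroup G] [T2Space G]
    (d d' : ℕ) (hdd' : d ≠ d') (hd : 3 ≤ d) (hd' : 3 ≤ d')
    (T : SimpleGraph V) (hT : T.IsTree)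
    (hreg : ∀ v : V, (T.neighborSet v).ncard = d)
    (ρ : G →* Equiv.Perm V)
    (hfaith : ∀ g : G, (∀ v : V, ρ g v = v) → g = 1)
    (htrans : ∀ u v : V, ∃ g : G, ρ g u = v)
    (hpres : ∀ (g : G) (u v : V), T.Adj u v → T.Adj (ρ g u) (ρ g v))
    (hfull : ∀ φ : T ≃g T, ∃ g : G, ∀ v : V, ρ g v = φ v)
    (hstab : ∀ v : V, IsCompact {g : G | ρ g v = v} ∧ IsOpen {g : G | ρ g v = v})
    (hbasis : (nhds (1 : G)).HasBasis (fun _ : Finset V => True)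
      (fun S : Finset V => {g : G | ∀ v ∈ S, ρ g v = v})) :
    ∀ (W : Type u) (T' : SimpleGraph W) (σ : G →* Equiv.Perm W),
      T'.IsTree → (∀ w : W, (T'.neighborSet w).ncard = d') →
      (∀ (g : G) (u w : W), T'.Adj u w → T'.Adj (σ g u) (σ g w)) →
      (∀ u w : W, ∃ g : G, σ g u = w) →
      (∀ w : W, IsCompact {g : G | σ g w = w} ∧ IsOpen {g : G | σ g w = w}) →
      False := by
  classical
  intro W T' σ hT' hreg' hpres' htrans' hstab'
  obtain ⟨v⟩ : Nonempty V := hT.1.nonempty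
  obtain ⟨w0⟩ : Nonempty W := hT'.1.nonempty
  have hsph : ∀ (v x y : V) (k : ℕ), T.dist v x = k + 1 → T.dist v y = k + 1 →
      ∃ (z : V) (g : G), T.dist v z = k + 1 ∧ z ≠ x ∧ z ≠ y ∧ ρ g v = v ∧ ρ g x = y ∧
      ρ g z = z := by
    intro v x y k hx hy
    obtain ⟨z, φ, h1, h2, h3, h4, h5, h6⟩ := sphere hT hd hreg hx hy
    obtain ⟨g, hg⟩ := hfull φ
    exact ⟨z, g, h1, h2, h3, by rw [hg, h4], by rw [hg, h5], by rw [hg, h6]⟩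
  -- the stabilizer of v preserves a vertex or an edge of the second tree
  obtain ⟨a, b, hab, hK⟩ : ∃ a b, (a = b ∨ T'.Adj a b) ∧ ∀ g, ρ g v = v →
      (σ g a = a ∧ σ g b = b) ∨ (σ g a = b ∧ σ g b = a) :=
    fixed_pair hT' σ hpres' (stab ρ v) w0
      (orbit_finite σ w0 (hstab' w0).2 _ (hstab v).1)
  have hmulV : ∀ (g h : G) (p : V), ρ (g * h) p = ρ g (ρ h p) := fun g h p => by
    rw [map_mul, Equiv.Perm.mul_apply]
  have hmulW : ∀ (g h : G) (p : W), σ (g * h) p = σ g (σ h p) := fun g h p => by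
    rw [map_mul, Equiv.Perm.mul_apply]
  have hinvV : ∀ (g : G) (p q : V), ρ g⁻¹ p = q ↔ p = ρ g q := fun g p q => by
    rw [map_inv, Equiv.Perm.inv_eq_iff_eq]
  have hinvW : ∀ (g : G) (p q : W), σ g⁻¹ p = q ↔ p = σ g q := fun g p q => by
    rw [map_inv, Equiv.Perm.inv_eq_iff_eq]
  have hdistv : ∀ g p, ρ g v = v → T.dist v (ρ g p) = T.dist v p := by
    intro g p hg
    have := act_dist hT ρ hpres g v p
    rwa [hg] at this
  have nonL : ∀ g0, ρ g0 v = v → σ g0 a ≠ a → ∀ k p, T.dist v p = k + 1 →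
      ∃ h, ρ h v = v ∧ ρ h p = p ∧ σ h a ≠ a := by
    intro g0 hg0 hg0a k p hp
    by_contra hcon
    push Not at hcon
    have hz : ∀ z, T.dist v z = k + 1 → ∀ h, ρ h v = v → ρ h z = z → σ h a = a := by
      intro z hz h hh hhz
      obtain ⟨-, c, -, -, -, hc, hcp, -⟩ := hsph v p z k hp hz
      have h1 := hcon (c⁻¹ * (h * c))
        (by rw [hmulV, hmulV, hc, hh, hinvV, hc])
        (by rw [hmulV, hmulV, hcp, hhz, hinvV, hcp])
      rw [hmulW, hmulW, hinvW] at h1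
      rcases hK c hc with ⟨h2, -⟩ | ⟨h2, -⟩
      · rwa [h2] at h1
      · rw [h2] at h1
        rcases hK h hh with ⟨h3, -⟩ | ⟨h3, h4⟩
        · exact h3
        · rw [h3, ← h4, h1]
    obtain ⟨z, h, hzd, -, -, hh, hhp, hhz⟩ := hsph v p (ρ g0 p) k hp
      (by rw [hdistv _ _ hg0, hp])
    have h1 := hz z hzd h hh hhz
    have h2 := hcon (h⁻¹ * g0) (by rw [hmulV, hg0, hinvV, hh]) (by rw [hmulV, hinvV, hhp])
    rw [hmulW, hinvW, h1] at h2
    exact hg0a h2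
  have transL : ∀ k p q, T.dist v p = k + 1 → T.dist v q = k + 1 →
      ∃ g, ρ g v = v ∧ ρ g p = q ∧ σ g a = a := by
    intro k p q hp hq
    obtain ⟨-, g, -, -, -, hg, hgp, -⟩ := hsph v p q k hp hq
    by_cases hga : σ g a = a
    · exact ⟨g, hg, hgp, hga⟩
    · obtain ⟨h, hh, hhp, hha⟩ := nonL g hg hga k p hp
      refine ⟨g * h, by rw [hmulV, hh, hg], by rw [hmulV, hhp, hgp], ?_⟩
      have h1 := (hK h hh).resolve_left (fun h => hha h.1)
      have h2 := (hK g hg).resolve_left (fun h => hga h.1)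
      rw [hmulW, h1.1, h2.2]
  -- the stabilizer of `a` fixes `v`
  have hHv : ∀ g, σ g a = a → ρ g v = v := by
    obtain ⟨x, y, -, hH⟩ : ∃ x y, (x = y ∨ T.Adj x y) ∧ ∀ g, σ g a = a →
        (ρ g x = x ∧ ρ g y = y) ∨ (ρ g x = y ∧ ρ g y = x) :=
      fixed_pair hT ρ hpres (stab σ a) v
        (orbit_finite ρ v (hstab v).2 _ (hstab' a).1)
    have gen : ∀ x y, (∀ g, σ g a = a →
        (ρ g x = x ∧ ρ g y = y) ∨ (ρ g x = y ∧ ρ g y = x)) → v = x := by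
      intro x y hH
      by_contra hne
      have h0 : T.dist v x ≠ 0 := fun h => hne ((dist_zero hT).1 h)
      obtain ⟨k, hk⟩ := Nat.exists_eq_succ_of_ne_zero h0
      obtain ⟨z, hz, hzx, hzy⟩ : ∃ z, T.dist v z = k + 1 ∧ z ≠ x ∧ z ≠ y := by
        by_cases hy : T.dist v y = k + 1
        · obtain ⟨z, -, h1, h2, h3, -⟩ := hsph v x y k hk hy
          exact ⟨z, h1, h2, h3⟩
        · obtain ⟨z, -, h1, h2, h3, -⟩ := hsph v x x k hk hk
          exact ⟨z, h1, h2, by rintro rfl; exact hy h1⟩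
      obtain ⟨g, -, hg, hga⟩ := transL k x z hk hz
      rcases hH g hga with ⟨h, -⟩ | ⟨h, -⟩
      · exact hzx (hg.symm.trans h)
      · exact hzy (hg.symm.trans h)
    have e1 := gen x y hH
    have e2 := gen y x (fun g hg => by have := hH g hg; tauto)
    intro g hg
    rcases hH g hg with ⟨h, -⟩ | ⟨h, -⟩
    · rw [e1, h]
    · rw [e1, h, ← e2, e1]
  by_cases hcase : ∀ g, ρ g v = v → σ g a = a
  · -- Case A : stabilizers agree
    choose γ hγ using htrans v
    have hwd : ∀ g p, ρ g v = p → σ g a = σ (γ p) a := by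
      intro g p hg
      have h1 := hcase ((γ p)⁻¹ * g) (by rw [hmulV, hinvV, hg, hγ])
      rwa [hmulW, hinvW] at h1
    obtain ⟨f, hfdef⟩ : ∃ f : V → W, ∀ p, f p = σ (γ p) a := ⟨_, fun _ => rfl⟩
    have hfeq : ∀ g p, f (ρ g p) = σ g (f p) := by
      intro g p
      rw [hfdef, hfdef, ← hmulW]
      exact (hwd _ _ (by rw [hmulV, hγ])).symm
    have hfinj : Function.Injective f := by
      intro p q hpq
      rw [hfdef, hfdef] at hpq
      have h1 := hHv ((γ q)⁻¹ * γ p) (by rw [hmulW, hinvW, hpq])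
      rwa [hmulV, hinvV, hγ, hγ] at h1
    have hfsurj : Function.Surjective f := by
      intro w
      obtain ⟨g, hg⟩ := htrans' a w
      exact ⟨ρ g v, by rw [hfdef, ← hwd g _ rfl, hg]⟩
    have hpair : ∀ k p q p' q', T.dist p q = k + 1 → T.dist p' q' = k + 1 →
        T'.Adj (f p) (f q) → T'.Adj (f p') (f q') := by
      intro k p q p' q' h1 h2 h3
      obtain ⟨g, hg⟩ := htrans p p'
      have h4 := act_dist hT ρ hpres g p q
      rw [hg, h1] at h4
      obtain ⟨-, h, -, -, -, hh, hhq, -⟩ := hsph p' _ _ k h4 h2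
      have h5 := hpres' h _ _ (hpres' g _ _ h3)
      rwa [← hfeq, ← hfeq, ← hfeq, ← hfeq, hg, hh, hhq] at h5
    have hle : ∀ p q, T'.Adj (f p) (f q) → T.Adj p q := by
      intro p q h
      have h0 : T.dist p q ≠ 0 := by
        intro h0
        rw [(dist_zero hT).1 h0] at h
        exact h.ne rfl
      by_contra hn
      have h1 : T.dist p q ≠ 1 := fun h1 => hn (adj_one.1 h1)
      obtain ⟨k, hk⟩ : ∃ k, T.dist p q = k + 2 := ⟨T.dist p q - 2, by omega⟩
      exact short_cycle hT hT' hd hreg f hfinj k p q hk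
        (fun p' q' h' => hpair (k + 1) p q p' q' hk h' h)
    obtain ⟨w1, hw1, -⟩ := third_nbr hd' hreg' (f v) (f v) (f v)
    obtain ⟨p1, rfl⟩ := hfsurj w1
    have hge : ∀ p q, T.Adj p q → T'.Adj (f p) (f q) := fun p q h =>
      hpair 0 v p1 p q (adj_one.2 (hle _ _ hw1)) (adj_one.2 h) hw1
    apply hdd'
    rw [← hreg v, ← hreg' (f v), ← Set.ncard_image_of_injective _ hfinj]
    congr 1
    ext w
    obtain ⟨q, rfl⟩ := hfsurj w
    constructor
    · rintro ⟨q', hq', h⟩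
      rw [← h]
      exact hge _ _ hq'
    · intro h
      exact ⟨q, hle _ _ h, rfl⟩
  · -- Case B : an edge is inverted
    push Not at hcase
    obtain ⟨h0, hh0, hh0a⟩ := hcase
    have hsw := (hK h0 hh0).resolve_left (fun h => hh0a h.1)
    have hne : a ≠ b := fun h => hh0a (by rw [hsw.1, ← h])
    have hadj := hab.resolve_left hne
    obtain ⟨w, hw, hwb, hwa⟩ := third_nbr hd' hreg' a b a
    obtain ⟨g, hg⟩ := htrans' a w
    have hgv : ρ g v ≠ v := by
      intro h
      rcases hK g h with ⟨h1, -⟩ | ⟨h1, -⟩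
      · exact hwa (hg.symm.trans h1)
      · exact hwb (hg.symm.trans h1)
    have hd0 : T.dist v (ρ g v) ≠ 0 := fun h => hgv ((dist_zero hT).1 h).symm
    obtain ⟨k, hk⟩ := Nat.exists_eq_succ_of_ne_zero hd0
    obtain ⟨h, hh, hhx, hha⟩ := nonL h0 hh0 hh0a k _ hk
    have hhs := (hK h hh).resolve_left (fun h => hha h.1)
    have hww : T'.Adj w (σ g b) := by
      rw [← hg]; exact hpres' g _ _ hadj
    have hga : σ g b ≠ a := by
      intro hgb
      have := hHv (g * h0) (by rw [hmulW, hsw.1, hgb])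
      rw [hmulV, hh0] at this
      exact hgv this
    have hbw : T'.Adj b (σ h w) := by
      have := hpres' h _ _ hw
      rwa [hhs.1] at this
    have hconj := hK (g⁻¹ * (h * g)) (by rw [hmulV, hmulV, hhx, hinvV])
    rcases hconj with ⟨h1, -⟩ | ⟨h1, -⟩
    · rw [hmulW, hmulW, hinvW, hg] at h1
      rw [h1] at hbw
      exact no_triangle hT' hadj hbw hw
    · rw [hmulW, hmulW, hinvW, hg] at h1
      rw [h1] at hbw
      exact no_square hT' hadj hbw hww.symm hw.symm hga.symm hwb.symm
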